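/- Let n ≥ 2 be a natural number, let φ⁺ : Fin n × Fin n → ℂ be the maximally entangled state vector φ⁺(i,j) = (1/√n) if i = j and 0 otherwise, and let Φ⁺ ∈ Matrix (Fin n × Fin n) (Fin n × Fin n) ℂ be its rank-one projector Φ⁺((i,j),(k,l)) = φ⁺(i,j) · conj(φ⁺(k,l)). There is no density matrix ρ on Fin n × Fin n × Fin n such that both the partial trace of ρ over the third factor equals Φ⁺ and the partial trace of ρ over the first factor equals Φ⁺; i.e. a tripartite quantum state cannot have both its AB marginal and its BC marginal maximally entangled (monogamy underlying the statement that there is no history |H_ABC) whose reduced histories |H_AB) and |H_BC) are both the maximally entangled history (|e₀)⊙|e₀) + |e₁)⊙|e₁))/√2). -/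

import Mathlib

open Matrix ComplexOrder

/-- The maximally entangled state vector `φ⁺(i,j) = 1/√n` if `i = j`, else `0`. -/
noncomputable def phiPlus (n : ℕ) : Fin n × Fin n → ℂ :=
  fun p => if p.1 = p.2 then ((Real.sqrt n : ℂ))⁻¹ else 0

/-- The rank-one projector `Φ⁺ = |φ⁺⟩⟨φ⁺|` onto the maximally entangled state. -/
noncomputable def PhiPlus (n : ℕ) : Matrix (Fin n × Fin n) (Fin n × Fin n) ℂ :=
  Matrix.of fun p q => phiPlus n p * star (phiPlus n q)

lemma psd_entry_zero {ι : Type*} [Fintype ι] {M : Matrix ι ι ℂ} (h : M.PosSemidef) (i j : ι)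
    (hi : M i i = 0) : M i j = 0 ∧ M j i = 0 := by
  have h2 := (h.submatrix ![i, j]).det_nonneg
  have hs : M j i = star (M i j) := (h.1.apply j i).symm
  rw [Matrix.det_fin_two] at h2
  simp only [Matrix.submatrix_apply, Matrix.cons_val_zero, Matrix.cons_val_one, hi, hs,
    zero_mul, zero_sub] at h2
  have h3 : M i j * star (M i j) = ((Complex.normSq (M i j) : ℝ) : ℂ) := Complex.mul_conj _
  rw [h3, ← Complex.ofReal_neg, Complex.zero_le_real] at h2
  have h4 : M i j = 0 := by
    rw [← Complex.normSq_eq_zero]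
    linarith [Complex.normSq_nonneg (M i j)]
  exact ⟨h4, by rw [hs, h4, star_zero]⟩

/-- **monogamy of maximal entanglement.** For `n ≥ 2`, there is
no density matrix `ρ` on the tripartite space `Fin n × Fin n × Fin n` such
that both the partial trace of `ρ` over the third factor and the partial trace
of `ρ` over the first factor equal the maximally entangled projector `Φ⁺`:
a tripartite state cannot have both its `AB` and `BC` marginals maximally
entangled. -/
theorem no_doubly_maximally_entangled_extension (n : ℕ) (hn : 2 ≤ n) :
    ¬ ∃ ρ : Matrix (Fin n × Fin n × Fin n) (Fin n × Fin n × Fin n) ℂ,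
      ρ.PosSemidef ∧ ρ.trace = 1 ∧
      (∀ a b a' b', (∑ c, ρ (a, b, c) (a', b', c)) = PhiPlus n (a, b) (a', b')) ∧
      (∀ b c b' c', (∑ a, ρ (a, b, c) (a, b', c')) = PhiPlus n (b, c) (b', c')) := by
  rintro ⟨ρ, hρ, -, h1, h2⟩
  have key : ∀ a b c : Fin n, b ≠ c → ρ (a, b, c) (a, b, c) = 0 := by
    intro a b c hbc
    have h := h2 b c b c
    have h0 : PhiPlus n (b, c) (b, c) = 0 := by simp [PhiPlus, phiPlus, hbc]
    rw [h0, Finset.sum_eq_zero_iff_of_nonneg (fun a _ => hρ.diag_nonneg)] at h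
    exact h a (Finset.mem_univ a)
  let x : Fin n := ⟨0, by omega⟩
  let y : Fin n := ⟨1, by omega⟩
  have hxy : x ≠ y := by simp [x, y]
  have h := h1 x x y y
  rw [Finset.sum_eq_zero] at h
  · have hn0 : n ≠ 0 := by omega
    simp [PhiPlus, phiPlus, hn0] at h
  · intro c _
    by_cases hc : x = c
    · have hy : y ≠ c := fun e => hxy (hc.trans e.symm)
      exact (psd_entry_zero hρ _ _ (key y y c hy)).2
    · exact (psd_entry_zero hρ _ _ (key x x c hc)).1
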